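/- Let b ∈ ℤ[i] be fourth-power-free, let d ∈ ℤ[i] be a square-free divisor of b, and let p be a primary prime of ℤ[i] with v_p(b) ∈ {1, 3} and p ∣ d. Set c := (b/d) / p^{v_p(b/d)} (the prime-to-p part of b/d). Then C_d(ℚ(i)_p) ≠ ∅ if and only if c^{(Nm(p)−1)/2} ≡ 1 (mod p). -/

import Mathlib

open IsDedekindDomain

noncomputable section

/-- The element `i` of the Gaussian integers `ℤ[i]`. -/
def ii : GaussianInt := ⟨0, 1⟩

/-- The element `1 + i` of `ℤ[i]`. -/
def tt : GaussianInt := 1 + ii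

/-- A Gaussian integer is *primary* if it is `≡ 1 (mod (1+i)³)`. -/
def IsPrimary (α : GaussianInt) : Prop := tt ^ 3 ∣ (α - 1)

/-- A Gaussian integer `b` is *fourth-power-free* if no fourth power of a prime divides it. -/
def FourthPowerFree (b : GaussianInt) : Prop := ∀ p : GaussianInt, Prime p → ¬ p ^ 4 ∣ b

/-- `HasLocalPoint b d π` says that the homogeneous space `C_d : d·w² = d² − 4·b·z⁴` has a
point in the completion `ℚ(i)_π` of `ℚ(i)` at the prime `π`, i.e. either the affine equation
`d·w² = d² − 4·b·z⁴` has a solution there, or `b/d` is a square there (the two points at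
infinity are rational).  This is the meaning of `C_d(ℚ(i)_π) ≠ ∅`. -/
def HasLocalPoint (b d π : GaussianInt) : Prop :=
  ∀ v : HeightOneSpectrum GaussianInt, v.asIdeal = Ideal.span {π} →
    (∃ z w : v.adicCompletion (FractionRing GaussianInt),
        algebraMap GaussianInt _ d * w ^ 2
          = (algebraMap GaussianInt _ d) ^ 2 - 4 * algebraMap GaussianInt _ b * z ^ 4)
    ∨ (∃ u : v.adicCompletion (FractionRing GaussianInt),
        u ^ 2 * algebraMap GaussianInt _ d = algebraMap GaussianInt _ b)

section Henselian

variable {R : Type*} [CommRing R]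

/-- One Newton step, with `a` an approximate inverse of `2 * x`. -/
theorem newton_step_sq {p c a x : R} {n : ℕ} (ha : p ∣ 1 - 2 * a * x)
    (hx : p ^ (n + 1) ∣ x ^ 2 - c) :
    p ^ (n + 2) ∣ (x - a * (x ^ 2 - c)) ^ 2 - c ∧
      p ∣ 1 - 2 * a * (x - a * (x ^ 2 - c)) := by
  obtain ⟨t, ht⟩ := ha
  obtain ⟨y, hy⟩ := hx
  constructor
  · refine ⟨y * t + a ^ 2 * y ^ 2 * p ^ n, ?_⟩
    linear_combination (1 - 2 * a * x + a ^ 2 * (x ^ 2 - c) + a ^ 2 * p ^ (n + 1) * y) * hy +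
      p ^ (n + 1) * y * ht
  · refine ⟨t + 2 * a ^ 2 * p ^ n * y, ?_⟩
    linear_combination ht + 2 * a ^ 2 * hy

theorem exists_seq_sq_sub_dvd {p c a x : R} (ha : p ∣ 1 - 2 * a * x) (hx : p ∣ x ^ 2 - c) :
    ∃ f : ℕ → R, ∀ n, p ^ (n + 1) ∣ f n ^ 2 - c ∧ p ^ (n + 1) ∣ f (n + 1) - f n := by
  let f : ℕ → R := fun n ↦ (fun y ↦ y - a * (y ^ 2 - c))^[n] x
  have hs (n : ℕ) : f (n + 1) = f n - a * (f n ^ 2 - c) := Function.iterate_succ_apply' _ _ _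
  have hf (n : ℕ) : p ^ (n + 1) ∣ f n ^ 2 - c ∧ p ∣ 1 - 2 * a * f n := by
    induction n with
    | zero => simpa [f] using ⟨hx, ha⟩
    | succ n ih => rw [hs]; exact newton_step_sq ih.2 ih.1
  refine ⟨f, fun n ↦ ⟨(hf n).1, ?_⟩⟩
  rw [hs, sub_sub_cancel_left, dvd_neg]
  exact (hf n).1.mul_left a

end Henselian

section AdicCompletion

open WithZero Filter Topology

variable {R : Type*} [CommRing R] [IsDedekindDomain R] {K : Type*} [Field K] [Algebra R K]
  [IsFractionRing R K] (v : HeightOneSpectrum R)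

theorem valued_algebraMap_adicCompletion (r : R) :
    Valued.v (algebraMap R (v.adicCompletion K) r) = v.intValuation r :=
  (v.valuedAdicCompletion_eq_valuation r).trans (v.valuation_of_algebraMap r)

theorem algebraMap_adicCompletion_injective :
    Function.Injective (algebraMap R (v.adicCompletion K)) := by
  rw [IsScalarTower.algebraMap_eq R K (v.adicCompletion K), RingHom.coe_comp]
  exact (algebraMap K (v.adicCompletion K)).injective.comp (IsFractionRing.injective R K)

variable {v}

instance : NonarchimedeanAddGroup (v.adicCompletion K) where
  is_nonarchimedean U hU := by
    obtain ⟨γ, hγ⟩ := Valued.mem_nhds_zero.1 hU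
    exact ⟨⟨Valued.v.restrict.ltAddSubgroup γ, Valued.isOpen_ball _ _⟩, hγ⟩

theorem tendsto_zero_of_valued_le_exp {f : ℕ → v.adicCompletion K}
    (hf : ∀ n : ℕ, Valued.v (f n) ≤ exp (-(n : ℤ))) : Tendsto f atTop (𝓝 0) := by
  intro s hs
  obtain ⟨γ, hγ⟩ := Valued.mem_nhds_zero.1 hs
  set g : ℤᵐ⁰ := MonoidWithZeroHom.ValueGroup₀.embedding γ.1 with hg
  have hg0 : g ≠ 0 := by simp [hg]
  refine mem_map.2 ?_
  filter_upwards [eventually_gt_atTop (-log g).toNat] with n hn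
  refine hγ ((Valuation.restrict_lt_iff_lt_embedding _).2 ((hf n).trans_lt ?_))
  rw [← hg, ← exp_log hg0, exp_lt_exp]
  omega

theorem valued_algebraMap_le_exp {p : R} (hv : v.asIdeal = Ideal.span {p}) {r : R} {n : ℕ}
    (h : p ^ n ∣ r) : Valued.v (algebraMap R (v.adicCompletion K) r) ≤ exp (-(n : ℤ)) := by
  rw [valued_algebraMap_adicCompletion, v.intValuation_le_pow_iff_mem, hv,
    Ideal.span_singleton_pow]
  exact Ideal.mem_span_singleton.2 h

theorem exists_sq_eq_algebraMap {p c x : R} (hv : v.asIdeal = Ideal.span {p})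
    (h2 : ¬ p ∣ 2) (hc : ¬ p ∣ c) (hx : p ∣ x ^ 2 - c) :
    ∃ s : v.adicCompletion K, s ^ 2 = algebraMap R _ c := by
  have hmem (r : R) : r ∈ v.asIdeal ↔ p ∣ r := by rw [hv, Ideal.mem_span_singleton]
  have h2x : 2 * x ∉ v.asIdeal := by
    intro h
    rcases v.isPrime.mem_or_mem h with h | h
    · exact h2 ((hmem _).1 h)
    · refine hc ((dvd_sub_right ?_).1 hx)
      exact dvd_pow ((hmem _).1 h) two_ne_zero
  obtain ⟨a, b, hb, hab⟩ := v.isMaximal.exists_inv h2x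
  have ha : p ∣ 1 - 2 * a * x := by
    rw [← hab, ← hmem]
    convert hb using 1
    ring
  obtain ⟨f, hf⟩ := exists_seq_sq_sub_dvd ha hx
  have hle {n : ℕ} {r : R} (h : p ^ (n + 1) ∣ r) :
      Valued.v (algebraMap R (v.adicCompletion K) r) ≤ exp (-(n : ℤ)) :=
    valued_algebraMap_le_exp hv ((pow_dvd_pow p n.le_succ).trans h)
  have hcau : CauchySeq fun n ↦ algebraMap R (v.adicCompletion K) (f n) := by
    apply NonarchimedeanAddGroup.cauchySeq_of_tendsto_sub_nhds_zero
    apply tendsto_zero_of_valued_le_exp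
    intro n
    rw [← map_sub]
    exact hle (hf n).2
  obtain ⟨s, hs⟩ := cauchySeq_tendsto_of_complete hcau
  refine ⟨s, sub_eq_zero.1 (tendsto_nhds_unique ((hs.pow 2).sub_const _) ?_)⟩
  apply tendsto_zero_of_valued_le_exp
  intro n
  rw [← map_pow, ← map_sub]
  exact hle (hf n).1

theorem exists_algebraMap_valued_sub_lt_one {s : v.adicCompletion K} (hs : Valued.v s ≤ 1) :
    ∃ x : R, Valued.v (algebraMap R (v.adicCompletion K) x - s) < 1 := by
  have hopen : IsOpen {y : v.adicCompletion K | Valued.v (y - s) < 1} := by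
    have := (Valued.isOpen_ball (v.adicCompletion K) 1).preimage
      (continuous_id.sub continuous_const : Continuous fun y ↦ y - s)
    simpa [Set.preimage, Valuation.restrict_lt_one_iff] using this
  obtain ⟨k, hk⟩ := (v.denseRange_algebraMap K).exists_mem_open hopen ⟨s, by simp⟩
  have hk' : Valued.v (algebraMap K (v.adicCompletion K) k - s) < 1 := hk
  have hvk : v.valuation K k ≤ 1 := by
    rw [← v.valuedAdicCompletion_eq_valuation' k]
    have := Valuation.map_add_le _ hk'.le hs
    rwa [sub_add_cancel] at this
  obtain ⟨x, hx⟩ := v.exists_valuation_sub_lt_of_integer hvk 1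
  refine ⟨x, ?_⟩
  rw [← v.valuedAdicCompletion_eq_valuation'] at hx
  have hx' : Valued.v (algebraMap R (v.adicCompletion K) x - algebraMap K _ k) < 1 := by
    rw [IsScalarTower.algebraMap_apply R K (v.adicCompletion K), ← map_sub]
    exact hx
  rw [← sub_add_sub_cancel _ (algebraMap K (v.adicCompletion K) k) s]
  exact Valuation.map_add_lt _ hx' hk'

theorem exists_dvd_sq_sub_of_valued_sq_sub_lt_one {p c : R} (hv : v.asIdeal = Ideal.span {p})
    {s : v.adicCompletion K} (h : Valued.v (s ^ 2 - algebraMap R _ c) < 1) :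
    ∃ x : R, p ∣ x ^ 2 - c := by
  have hc : Valued.v (algebraMap R (v.adicCompletion K) c) ≤ 1 := by
    rw [valued_algebraMap_adicCompletion]
    exact v.intValuation_le_one c
  have hs : Valued.v s ≤ 1 := by
    have := Valuation.map_add_le _ h.le hc
    rw [sub_add_cancel, map_pow] at this
    exact (pow_le_one_iff two_ne_zero).1 this
  obtain ⟨x, hx⟩ := exists_algebraMap_valued_sub_lt_one hs
  refine ⟨x, ?_⟩
  rw [← Ideal.mem_span_singleton, ← hv, ← v.intValuation_lt_one_iff_mem,
    ← valued_algebraMap_adicCompletion (K := K)]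
  have hx1 : Valued.v (algebraMap R (v.adicCompletion K) x + s) ≤ 1 := by
    refine Valuation.map_add_le _ ?_ hs
    rw [valued_algebraMap_adicCompletion]
    exact v.intValuation_le_one x
  have key : algebraMap R (v.adicCompletion K) (x ^ 2 - c) =
      (algebraMap R _ x - s) * (algebraMap R _ x + s) + (s ^ 2 - algebraMap R _ c) := by
    rw [map_sub, map_pow]; ring
  rw [key]
  refine Valuation.map_add_lt _ ?_ h
  rw [map_mul]
  exact mul_lt_one_of_lt_of_le hx hx1

theorem sq_ne_exp_neg_one (x : ℤᵐ⁰) : x ^ 2 ≠ exp (-1 : ℤ) := by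
  intro h
  have := congrArg log h
  rw [log_pow, log_exp, nsmul_eq_mul] at this
  push_cast at this
  omega

/-- A norm form `w² - c y²` with unit `c` representing a uniformizer forces `c` to be a square
modulo the maximal ideal. -/
theorem exists_valued_sq_sub_lt_one {c w y : v.adicCompletion K} (hc : Valued.v c = 1)
    (h : Valued.v (w ^ 2 - c * y ^ 2) = exp (-1 : ℤ)) :
    ∃ s : v.adicCompletion K, Valued.v (s ^ 2 - c) < 1 := by
  have hcy : Valued.v (c * y ^ 2) = Valued.v y ^ 2 := by rw [map_mul, hc, one_mul, map_pow]
  have hlt : exp (-1 : ℤ) < Valued.v y ^ 2 := by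
    by_contra! hle
    have hlt := hle.lt_of_ne (sq_ne_exp_neg_one _)
    rw [← h, ← hcy] at hlt
    have := Valuation.map_add_eq_of_lt_left _ hlt
    rw [sub_add_cancel, map_pow, h] at this
    exact sq_ne_exp_neg_one _ this
  have hy : y ≠ 0 := by
    rintro rfl
    simp at hlt
  refine ⟨w / y, ?_⟩
  have : (w / y) ^ 2 - c = (w ^ 2 - c * y ^ 2) / y ^ 2 := by field_simp
  rw [this, map_div₀, h, map_pow]
  exact (div_lt_one₀ (exp_pos.trans hlt)).2 hlt

end AdicCompletion

namespace GaussianInt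

def basis : Module.Basis (Fin 2) ℤ GaussianInt :=
  .ofEquivFun
    { toFun x := ![x.re, x.im]
      invFun f := ⟨f 0, f 1⟩
      map_add' x y := by ext i; fin_cases i <;> simp
      map_smul' a x := by ext i; fin_cases i <;> simp
      left_inv x := rfl
      right_inv f := by ext i; fin_cases i <;> rfl }

instance : Module.Free ℤ GaussianInt := .of_basis basis
instance : Module.Finite ℤ GaussianInt := .of_basis basis

theorem algebraNorm_eq_norm (x : GaussianInt) : Algebra.norm ℤ x = x.norm := by
  rw [Algebra.norm_eq_matrix_det basis, Matrix.det_fin_two]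
  have h0 : basis 0 = 1 := by
    rw [basis, Module.Basis.coe_ofEquivFun]; rfl
  have h1 : basis 1 = ⟨0, 1⟩ := by
    rw [basis, Module.Basis.coe_ofEquivFun]; rfl
  have hr (y : GaussianInt) : basis.repr y 0 = y.re ∧ basis.repr y 1 = y.im := ⟨rfl, rfl⟩
  simp [Algebra.leftMulMatrix_eq_repr_mul, hr, h0, h1, Zsqrtd.norm_def]

theorem card_quotient_span_singleton (x : GaussianInt) :
    Nat.card (GaussianInt ⧸ Ideal.span {x}) = x.norm.natAbs := by
  rw [← algebraNorm_eq_norm, ← Ideal.absNorm_span_singleton, Ideal.absNorm_apply,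
    Submodule.cardQuot_apply]

theorem dvd_pow_half_norm_sub_one_iff {p c : GaussianInt} (hp : Prime p) (h2 : ¬ p ∣ 2)
    (hc : ¬ p ∣ c) :
    p ∣ c ^ ((p.norm.natAbs - 1) / 2) - 1 ↔ ∃ x, p ∣ x ^ 2 - c := by
  set I := Ideal.span {p}
  have hmk (x y : GaussianInt) : p ∣ x - y ↔ Ideal.Quotient.mk I x = Ideal.Quotient.mk I y := by
    rw [Ideal.Quotient.eq, Ideal.mem_span_singleton]
  have hmax : I.IsMaximal := PrincipalIdealRing.isMaximal_of_irreducible hp.irreducible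
  let : Field (GaussianInt ⧸ I) := Ideal.Quotient.field I
  have hcard : Nat.card (GaussianInt ⧸ I) = p.norm.natAbs := card_quotient_span_singleton p
  have : Finite (GaussianInt ⧸ I) := by
    apply Nat.finite_of_card_ne_zero
    rw [hcard]
    simpa using hp.ne_zero
  let := Fintype.ofFinite (GaussianInt ⧸ I)
  rw [Nat.card_eq_fintype_card] at hcard
  have hchar : ringChar (GaussianInt ⧸ I) ≠ 2 := by
    intro h
    apply h2
    rw [← Ideal.mem_span_singleton, ← Ideal.Quotient.eq_zero_iff_mem, map_ofNat]
    simpa [h] using ringChar.Nat.cast_ringChar (R := GaussianInt ⧸ I)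
  have hodd := FiniteField.odd_card_of_char_ne_two hchar
  have hc0 : Ideal.Quotient.mk I c ≠ 0 := by
    rwa [Ne, Ideal.Quotient.eq_zero_iff_mem, Ideal.mem_span_singleton]
  have hhalf : (p.norm.natAbs - 1) / 2 = Fintype.card (GaussianInt ⧸ I) / 2 := by
    omega
  rw [hmk, hhalf, map_pow, map_one, ← FiniteField.isSquare_iff hchar hc0, isSquare_iff_exists_sq]
  simp only [hmk, map_pow, Ideal.Quotient.mk_surjective.exists, eq_comm]

end GaussianInt

theorem IsPrimary.not_dvd_two {p : GaussianInt} (hprim : IsPrimary p) (hp : Prime p) :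
    ¬ p ∣ 2 := by
  have htt : (2 : GaussianInt) = tt ^ 2 * -ii := by decide
  intro h
  have hptt : p ∣ tt := by
    rw [htt] at h
    rcases hp.dvd_or_dvd h with h | h
    · exact hp.dvd_of_dvd_pow h
    · exact absurd (isUnit_of_dvd_unit h (IsUnit.of_mul_eq_one ii (by decide))) hp.not_isUnit
  have h1 : p ∣ p - 1 := (hptt.trans (dvd_pow_self tt three_ne_zero)).trans hprim
  exact hp.not_dvd_one ((dvd_sub_right dvd_rfl).1 h1)

/-- Divisibility bookkeeping: the exponent is even. -/
theorem even_exponent {R : Type*} [CommRing R] [IsDomain R] {p d c : R} {k : ℕ} (hp : Prime p)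
    (hd : Squarefree d) (hpd : p ∣ d) (hpc : ¬ p ∣ c)
    (h : (p ∣ d * (p ^ k * c) ∧ ¬ p ^ 2 ∣ d * (p ^ k * c)) ∨
      (p ^ 3 ∣ d * (p ^ k * c) ∧ ¬ p ^ 4 ∣ d * (p ^ k * c))) : Even k := by
  obtain ⟨d', rfl⟩ := hpd
  have hd' : ¬ p ∣ d' := fun h ↦ hp.not_isUnit (hd p (mul_dvd_mul_left p h))
  have hdc : ¬ p ∣ d' * c := hp.dvd_mul.not.2 (not_or.2 ⟨hd', hpc⟩)
  have hdvd (n : ℕ) : p ^ n ∣ p * d' * (p ^ k * c) ↔ n ≤ k + 1 := by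
    have : p * d' * (p ^ k * c) = p ^ (k + 1) * (d' * c) := by ring
    rw [this]
    refine ⟨fun h ↦ ?_, fun h ↦ (pow_dvd_pow p h).mul_right _⟩
    by_contra! hlt
    have h' := (pow_dvd_pow p hlt).trans h
    rw [pow_succ, mul_dvd_mul_iff_left (pow_ne_zero _ hp.ne_zero)] at h'
    exact hdc h'
  simp only [hdvd] at h
  have : k = 0 ∨ k = 2 := by omega
  rcases this with rfl | rfl <;> decide

/-- **Statement 7.**  Let `b ∈ ℤ[i]` be fourth-power-free, `d` a square-free divisor of `b`,
and `p` a primary prime with `v_p(b) ∈ {1,3}` and `p ∣ d`.  Write `b = d * e` and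
`e = p ^ k * c` with `p ∤ c`, so that `c` is the prime-to-`p` part of `b/d`.  Then
`C_d(ℚ(i)_p) ≠ ∅` iff `c^{(Nm(p)−1)/2} ≡ 1 (mod p)`. -/
theorem local_solubility_case3 (b d p e c : GaussianInt) (k : ℕ)
    (hb4 : FourthPowerFree b) (hd : Squarefree d) (hdvd : b = d * e)
    (hp : Prime p) (hprim : IsPrimary p)
    (hvp : (p ∣ b ∧ ¬ p ^ 2 ∣ b) ∨ (p ^ 3 ∣ b ∧ ¬ p ^ 4 ∣ b))
    (hpd : p ∣ d)
    (hc : e = p ^ k * c) (hpc : ¬ p ∣ c) :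
    HasLocalPoint b d p ↔ p ∣ (c ^ ((p.norm.natAbs - 1) / 2) - 1) := by
  have h2 := hprim.not_dvd_two hp
  rw [GaussianInt.dvd_pow_half_norm_sub_one_iff hp h2 hpc]
  subst hdvd hc
  obtain ⟨m, rfl⟩ := even_exponent hp hd hpd hpc hvp
  have hd0 : d ≠ 0 := hd.ne_zero
  constructor
  · intro H
    let v : HeightOneSpectrum GaussianInt :=
      ⟨Ideal.span {p}, (Ideal.span_singleton_prime hp.ne_zero).2 hp, by simpa using hp.ne_zero⟩
    have hv : v.asIdeal = Ideal.span {p} := rfl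
    have hinj := algebraMap_adicCompletion_injective (K := FractionRing GaussianInt) v
    have hd0' := (map_ne_zero_iff _ hinj).2 hd0
    have hp0' := (map_ne_zero_iff _ hinj).2 hp.ne_zero
    have hnorm {r : GaussianInt} (hr : ¬ p ∣ r) : Valued.v
        (algebraMap GaussianInt (v.adicCompletion (FractionRing GaussianInt)) r) = 1 := by
      rw [valued_algebraMap_adicCompletion, v.intValuation_eq_one_iff, hv,
        Ideal.mem_span_singleton]
      exact hr
    obtain ⟨z, w, h⟩ | ⟨u, h⟩ := H v hv
    · have hvd : Valued.v (algebraMap GaussianInt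
          (v.adicCompletion (FractionRing GaussianInt)) d) = WithZero.exp (-1 : ℤ) := by
        obtain ⟨d', rfl⟩ := hpd
        have hd' : ¬ p ∣ d' := fun h ↦ hp.not_isUnit (hd p (mul_dvd_mul_left p h))
        rw [map_mul, map_mul, hnorm hd', mul_one, valued_algebraMap_adicCompletion,
          v.intValuation_singleton hp.ne_zero hv]
      have hi : (algebraMap GaussianInt (v.adicCompletion (FractionRing GaussianInt)) ii) ^ 2 =
          -1 := by
        rw [← map_pow, show ii ^ 2 = -1 by decide, map_neg, map_one]
      have heq : w ^ 2 - algebraMap GaussianInt _ c *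
          (2 * algebraMap GaussianInt _ ii * algebraMap GaussianInt _ p ^ m * z ^ 2) ^ 2 =
          algebraMap GaussianInt _ d := by
        apply mul_left_cancel₀ hd0'
        simp only [map_mul, map_pow] at h
        linear_combination h - 4 * algebraMap GaussianInt _ d * algebraMap GaussianInt _ c *
          algebraMap GaussianInt _ p ^ (2 * m) * z ^ 4 * hi
      obtain ⟨s, hs⟩ := exists_valued_sq_sub_lt_one (hnorm hpc) (heq ▸ hvd)
      exact exists_dvd_sq_sub_of_valued_sq_sub_lt_one hv hs
    · refine exists_dvd_sq_sub_of_valued_sq_sub_lt_one hv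
        (s := u / algebraMap GaussianInt _ p ^ m) ?_
      have : (u / algebraMap GaussianInt _ p ^ m) ^ 2 = algebraMap GaussianInt _ c := by
        rw [div_pow, div_eq_iff (pow_ne_zero _ (pow_ne_zero _ hp0'))]
        apply mul_left_cancel₀ hd0'
        simp only [map_mul, map_pow] at h
        linear_combination h
      simp [this]
  · rintro ⟨x, hx⟩ v hv
    obtain ⟨s, hs⟩ := exists_sq_eq_algebraMap (K := FractionRing GaussianInt) hv h2 hpc hx
    refine .inr ⟨algebraMap GaussianInt _ p ^ m * s, ?_⟩
    simp only [map_mul, map_pow]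
    rw [← hs]
    ring
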